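/- There exists a universal constant c₂ > 0 such that the following holds. Let 0 < ε ≤ 1/10 and δ ≥ ε. Let G* be a set of n points in ℝ^d that is (ε,δ)-spectrally stable with respect to μ ∈ ℝ^d, let S be an ε-corruption of G*, let G be the set of unchanged indices (|G| ≥ (1−ε)n), and let w* be the uniform weights on G. Then for every w ∈ Δ_{n,ε} with ‖μ_w − μ‖₂ ≥ c₂·δ (computed from S) and every η ∈ (0,1): ‖Σ_{(1−η)w + ηw*} − I‖₂ ≤ (1 − η/2)·‖Σ_w − I‖₂, where ‖·‖₂ on matrices denotes the spectral norm. -/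

import Mathlib

open Finset MeasureTheory

/-- Euclidean (`ℓ₂`) norm of a vector in `ℝ^d`. -/
noncomputable def norm2 {d : ℕ} (x : Fin d → ℝ) : ℝ :=
  Real.sqrt (∑ i, (x i) ^ 2)

/-- The `(2,k)`-norm: max `ℓ₂` norm over `k` entries. -/
noncomputable def norm2k {d : ℕ} (k : ℕ) (x : Fin d → ℝ) : ℝ :=
  sSup {r : ℝ | ∃ S : Finset (Fin d), S.card = k ∧ r = Real.sqrt (∑ i ∈ S, (x i) ^ 2)}

/-- The `(F,k,k)`-norm: `‖A‖_{F,k,k}² = max_{|S|=k} Σ_{i∈S} ‖A_i‖_{2,k}²`. -/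
noncomputable def normFkk {d : ℕ} (k : ℕ) (A : Matrix (Fin d) (Fin d) ℝ) : ℝ :=
  Real.sqrt (sSup {r : ℝ | ∃ S : Finset (Fin d), S.card = k ∧
    r = ∑ i ∈ S, (norm2k k (A i)) ^ 2})

/-- The `(F,m)`-norm: max Frobenius norm over `m` entries of the matrix. -/
noncomputable def normFm {d : ℕ} (m : ℕ) (A : Matrix (Fin d) (Fin d) ℝ) : ℝ :=
  sSup {r : ℝ | ∃ Q : Finset (Fin d × Fin d), Q.card = m ∧
    r = Real.sqrt (∑ p ∈ Q, (A p.1 p.2) ^ 2)}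

/-- Frobenius norm. -/
noncomputable def frobNorm {d : ℕ} (A : Matrix (Fin d) (Fin d) ℝ) : ℝ :=
  Real.sqrt (∑ a, ∑ b, (A a b) ^ 2)

/-- Spectral norm (operator `ℓ₂ → ℓ₂` norm). -/
noncomputable def specNorm {d : ℕ} (A : Matrix (Fin d) (Fin d) ℝ) : ℝ :=
  sSup {r : ℝ | ∃ x : Fin d → ℝ, norm2 x = 1 ∧ r = norm2 (A.mulVec x)}

/-- Quadratic form `vᵀ A v`. -/
noncomputable def quadForm {d : ℕ} (A : Matrix (Fin d) (Fin d) ℝ) (v : Fin d → ℝ) : ℝ :=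
  ∑ a, ∑ b, v a * A a b * v b

/-- Ky Fan 2-norm of a symmetric matrix: max of `|uᵀAu| + |vᵀAv|` over orthonormal pairs. -/
noncomputable def kyFan2 {d : ℕ} (A : Matrix (Fin d) (Fin d) ℝ) : ℝ :=
  sSup {r : ℝ | ∃ u v : Fin d → ℝ, norm2 u = 1 ∧ norm2 v = 1 ∧ (∑ i, u i * v i) = 0 ∧
    r = |quadForm A u| + |quadForm A v|}

/-- `x` has at most `k` nonzero entries. -/
def sparseLE {d : ℕ} (k : ℕ) (x : Fin d → ℝ) : Prop :=
  ∃ S : Finset (Fin d), S.card ≤ k ∧ ∀ i, i ∉ S → x i = 0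

/-- `A_Q`: the matrix equal to `A` on the entry set `Q` and zero elsewhere. -/
def matRestrict {d : ℕ} (A : Matrix (Fin d) (Fin d) ℝ) (Q : Finset (Fin d × Fin d)) :
    Matrix (Fin d) (Fin d) ℝ :=
  Matrix.of fun a b => if (a, b) ∈ Q then A a b else 0

/-- `Δ_{n,ε}`. -/
def Delta (n : ℕ) (ε : ℝ) : Set (Fin n → ℝ) :=
  {w | (∑ i, w i) = 1 ∧ ∀ i, 0 ≤ w i ∧ w i ≤ 1 / ((1 - ε) * n)}

/-- Weighted empirical mean `μ_w`. -/
noncomputable def muW {n d : ℕ} (X : Fin n → Fin d → ℝ) (w : Fin n → ℝ) : Fin d → ℝ :=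
  fun j => ∑ i, w i * X i j

/-- Weighted empirical covariance `Σ_w`. -/
noncomputable def SigmaW {n d : ℕ} (X : Fin n → Fin d → ℝ) (w : Fin n → ℝ) :
    Matrix (Fin d) (Fin d) ℝ :=
  Matrix.of fun a b => ∑ i, w i * (X i a - muW X w a) * (X i b - muW X w b)

/-- Weighted second moment `M_w`. -/
noncomputable def MW {n d : ℕ} (X : Fin n → Fin d → ℝ) (w : Fin n → ℝ) :
    Matrix (Fin d) (Fin d) ℝ :=
  Matrix.of fun a b => ∑ i, w i * X i a * X i b

/-- `(k,ε,δ)`-stability for sparse mean estimation. -/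
def stableMean {n d : ℕ} (k : ℕ) (ε δ : ℝ) (X : Fin n → Fin d → ℝ) (μ : Fin d → ℝ) : Prop :=
  ∀ w ∈ Delta n (2 * ε),
    norm2k k (fun j => muW X w j - μ j) ≤ δ ∧ normFkk k (SigmaW X w - 1) ≤ δ ^ 2 / ε

/-- `(ε,δ)`-spectral stability for (non-sparse) mean estimation. -/
def stableSpec {n d : ℕ} (ε δ : ℝ) (X : Fin n → Fin d → ℝ) (μ : Fin d → ℝ) : Prop :=
  ∀ w ∈ Delta n (2 * ε),
    norm2 (fun j => muW X w j - μ j) ≤ δ ∧ specNorm (SigmaW X w - 1) ≤ δ ^ 2 / ε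

/-- `(k,ε,δ)`-stability for sparse PCA. -/
def stablePCA {n d : ℕ} (k : ℕ) (ε δ ρ : ℝ) (X : Fin n → Fin d → ℝ) (v : Fin d → ℝ) : Prop :=
  ∀ w ∈ Delta n (2 * ε),
    normFm (2 * k ^ 2) (MW X w - (1 + ρ • Matrix.vecMulVec v v)) ≤ δ

/-- `(ε,δ)`-KF2-stability for (non-sparse) PCA. -/
def stableKF2 {n d : ℕ} (ε δ ρ : ℝ) (X : Fin n → Fin d → ℝ) (v : Fin d → ℝ) : Prop :=
  ∀ w ∈ Delta n (2 * ε),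
    kyFan2 (MW X w - (1 + ρ • Matrix.vecMulVec v v)) ≤ δ

/-- `X` is an `ε`-corruption of `Xstar`: they differ in at most `εn` indices. -/
def isCorruption {n d : ℕ} (ε : ℝ) (X Xstar : Fin n → Fin d → ℝ) : Prop :=
  ∃ B : Finset (Fin n), (B.card : ℝ) ≤ ε * n ∧ ∀ i, i ∉ B → X i = Xstar i

/-- Uniform weight vector on a finite index set `G`. -/
noncomputable def uniformOn {n : ℕ} (G : Finset (Fin n)) : Fin n → ℝ :=
  fun i => if i ∈ G then ((G.card : ℝ))⁻¹ else 0

theorem norm2_eq_norm {d : ℕ} (x : Fin d → ℝ) : norm2 x = ‖WithLp.toLp 2 x‖ := by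
  simp [norm2, EuclideanSpace.norm_eq]

theorem norm2_nonneg {d : ℕ} (x : Fin d → ℝ) : 0 ≤ norm2 x := Real.sqrt_nonneg _

theorem norm2_sq {d : ℕ} (x : Fin d → ℝ) : norm2 x ^ 2 = x ⬝ᵥ x := by
  rw [norm2, Real.sq_sqrt (Finset.sum_nonneg fun i _ => sq_nonneg _)]
  simp [dotProduct, sq]

theorem norm2_add_le {d : ℕ} (x y : Fin d → ℝ) : norm2 (x + y) ≤ norm2 x + norm2 y := by
  simpa [norm2_eq_norm] using norm_add_le (WithLp.toLp 2 x) (WithLp.toLp 2 y)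

theorem norm2_sub_le {d : ℕ} (x y : Fin d → ℝ) : norm2 (x - y) ≤ norm2 x + norm2 y := by
  simpa [norm2_eq_norm] using norm_sub_le (WithLp.toLp 2 x) (WithLp.toLp 2 y)

theorem norm2_smul {d : ℕ} (c : ℝ) (x : Fin d → ℝ) : norm2 (c • x) = |c| * norm2 x := by
  simp [norm2_eq_norm, norm_smul]

theorem abs_dotProduct_le_norm2_mul_norm2 {d : ℕ} (x y : Fin d → ℝ) :
    |x ⬝ᵥ y| ≤ norm2 x * norm2 y := by
  have h := abs_real_inner_le_norm (WithLp.toLp 2 y) (WithLp.toLp 2 x)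
  rw [EuclideanSpace.inner_toLp_toLp] at h
  simpa [norm2_eq_norm, mul_comm] using h

theorem specNorm_nonneg {d : ℕ} (A : Matrix (Fin d) (Fin d) ℝ) : 0 ≤ specNorm A := by
  apply Real.sSup_nonneg
  rintro r ⟨x, -, rfl⟩
  exact norm2_nonneg _

theorem norm2_mulVec_le_specNorm {d : ℕ} (A : Matrix (Fin d) (Fin d) ℝ) {x : Fin d → ℝ}
    (hx : norm2 x = 1) : norm2 (A.mulVec x) ≤ specNorm A := by
  refine le_csSup ⟨‖Matrix.toEuclideanCLM (𝕜 := ℝ) A‖, ?_⟩ ⟨x, hx, rfl⟩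
  rintro r ⟨y, hy, rfl⟩
  have h := (Matrix.toEuclideanCLM (𝕜 := ℝ) A).le_opNorm (WithLp.toLp 2 y)
  rwa [Matrix.toEuclideanCLM_toLp, ← norm2_eq_norm, ← norm2_eq_norm, hy, mul_one] at h

theorem specNorm_le {d : ℕ} {A : Matrix (Fin d) (Fin d) ℝ} {c : ℝ} (hc : 0 ≤ c)
    (h : ∀ x, norm2 x = 1 → norm2 (A.mulVec x) ≤ c) : specNorm A ≤ c := by
  refine Real.sSup_le ?_ hc
  rintro r ⟨x, hx, rfl⟩
  exact h x hx

theorem specNorm_add_le {d : ℕ} (A B : Matrix (Fin d) (Fin d) ℝ) :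
    specNorm (A + B) ≤ specNorm A + specNorm B := by
  refine specNorm_le (add_nonneg (specNorm_nonneg A) (specNorm_nonneg B)) fun x hx => ?_
  rw [Matrix.add_mulVec]
  exact (norm2_add_le _ _).trans
    (add_le_add (norm2_mulVec_le_specNorm A hx) (norm2_mulVec_le_specNorm B hx))

theorem specNorm_smul_le {d : ℕ} {c : ℝ} (hc : 0 ≤ c) (A : Matrix (Fin d) (Fin d) ℝ) :
    specNorm (c • A) ≤ c * specNorm A := by
  refine specNorm_le (mul_nonneg hc (specNorm_nonneg A)) fun x hx => ?_
  rw [Matrix.smul_mulVec, norm2_smul, abs_of_nonneg hc]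
  exact mul_le_mul_of_nonneg_left (norm2_mulVec_le_specNorm A hx) hc

theorem specNorm_vecMulVec_self_le {d : ℕ} (u : Fin d → ℝ) :
    specNorm (Matrix.vecMulVec u u) ≤ norm2 u ^ 2 := by
  refine specNorm_le (sq_nonneg _) fun x hx => ?_
  have h : (Matrix.vecMulVec u u).mulVec x = (u ⬝ᵥ x) • u := by
    rw [Matrix.vecMulVec_mulVec]
    simp
  rw [h, norm2_smul, sq]
  refine mul_le_mul_of_nonneg_right ?_ (norm2_nonneg u)
  simpa [hx] using abs_dotProduct_le_norm2_mul_norm2 u x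

theorem abs_dotProduct_mulVec_le_specNorm {d : ℕ} (A : Matrix (Fin d) (Fin d) ℝ)
    {v : Fin d → ℝ} (hv : norm2 v = 1) : |v ⬝ᵥ A.mulVec v| ≤ specNorm A := by
  have h := abs_dotProduct_le_norm2_mul_norm2 v (A.mulVec v)
  rw [hv, one_mul] at h
  exact h.trans (norm2_mulVec_le_specNorm A hv)

theorem abs_dotProduct_mulVec_sub_one_le_specNorm {d : ℕ} (A : Matrix (Fin d) (Fin d) ℝ)
    {v : Fin d → ℝ} (hv : norm2 v = 1) : |v ⬝ᵥ A.mulVec v - 1| ≤ specNorm (A - 1) := by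
  have h := abs_dotProduct_mulVec_le_specNorm (A - 1) hv
  rwa [Matrix.sub_mulVec, Matrix.one_mulVec, dotProduct_sub, ← norm2_sq, hv, one_pow] at h

theorem SigmaW_apply {n d : ℕ} (X : Fin n → Fin d → ℝ) {w : Fin n → ℝ} (hw : ∑ i, w i = 1)
    (a b : Fin d) :
    SigmaW X w a b = ∑ i, w i * X i a * X i b - muW X w a * muW X w b := by
  have h : ∀ i, w i * (X i a - muW X w a) * (X i b - muW X w b) =
      w i * X i a * X i b - muW X w b * (w i * X i a) - muW X w a * (w i * X i b)
        + muW X w a * muW X w b * w i := fun i => by ring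
  simp only [SigmaW, Matrix.of_apply, h, Finset.sum_add_distrib, Finset.sum_sub_distrib,
    ← Finset.mul_sum, hw]
  simp only [muW]
  ring

theorem muW_combination {n d : ℕ} (X : Fin n → Fin d → ℝ) (w v : Fin n → ℝ) (s t : ℝ) :
    muW X (fun i => s * w i + t * v i) = s • muW X w + t • muW X v := by
  ext j
  simp [muW, add_mul, Finset.sum_add_distrib, Finset.mul_sum, mul_assoc]

theorem SigmaW_convexCombination {n d : ℕ} (X : Fin n → Fin d → ℝ) {w v : Fin n → ℝ}
    (hw : ∑ i, w i = 1) (hv : ∑ i, v i = 1) (η : ℝ) :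
    SigmaW X (fun i => (1 - η) * w i + η * v i) = (1 - η) • SigmaW X w + η • SigmaW X v +
      (η * (1 - η)) • Matrix.vecMulVec (muW X w - muW X v) (muW X w - muW X v) := by
  have hsum : ∑ i, ((1 - η) * w i + η * v i) = 1 := by
    rw [Finset.sum_add_distrib, ← Finset.mul_sum, ← Finset.mul_sum, hw, hv]
    ring
  ext a b
  have h : ∑ i, ((1 - η) * w i + η * v i) * X i a * X i b =
      (1 - η) * ∑ i, w i * X i a * X i b + η * ∑ i, v i * X i a * X i b := by
    rw [Finset.mul_sum, Finset.mul_sum, ← Finset.sum_add_distrib]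
    exact Finset.sum_congr rfl fun i _ => by ring
  rw [SigmaW_apply X hsum, muW_combination, h]
  simp only [Matrix.add_apply, Matrix.smul_apply, Matrix.vecMulVec_apply, SigmaW_apply X hw,
    SigmaW_apply X hv, Pi.add_apply, Pi.sub_apply, Pi.smul_apply, smul_eq_mul]
  ring

theorem dotProduct_muW {n d : ℕ} (X : Fin n → Fin d → ℝ) (w : Fin n → ℝ) (v : Fin d → ℝ) :
    v ⬝ᵥ muW X w = ∑ i, w i * (v ⬝ᵥ X i) := by
  have h : muW X w = ∑ i, w i • X i := by
    ext j
    simp [muW]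
  simp [h, dotProduct_sum]

theorem dotProduct_SigmaW_mulVec {n d : ℕ} (X : Fin n → Fin d → ℝ) (w : Fin n → ℝ)
    (v : Fin d → ℝ) :
    v ⬝ᵥ (SigmaW X w).mulVec v = ∑ i, w i * (v ⬝ᵥ X i - v ⬝ᵥ muW X w) ^ 2 := by
  have h : SigmaW X w =
      ∑ i, w i • Matrix.vecMulVec (X i - muW X w) (X i - muW X w) := by
    ext a b
    simp [SigmaW, Matrix.sum_apply, Matrix.vecMulVec_apply, mul_assoc]
  rw [h, Matrix.sum_mulVec, dotProduct_sum]
  refine Finset.sum_congr rfl fun i _ => ?_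
  rw [Matrix.smul_mulVec, Matrix.vecMulVec_mulVec, ← dotProduct_sub]
  simp [dotProduct_comm _ v, sq]

theorem muW_congr {n d : ℕ} {X Y : Fin n → Fin d → ℝ} {w : Fin n → ℝ}
    (h : ∀ i, w i ≠ 0 → X i = Y i) : muW X w = muW Y w := by
  ext j
  refine Finset.sum_congr rfl fun i _ => ?_
  by_cases hi : w i = 0
  · simp [hi]
  · rw [h i hi]

theorem SigmaW_congr {n d : ℕ} {X Y : Fin n → Fin d → ℝ} {w : Fin n → ℝ}
    (h : ∀ i, w i ≠ 0 → X i = Y i) : SigmaW X w = SigmaW Y w := by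
  ext a b
  simp only [SigmaW, Matrix.of_apply, muW_congr h]
  refine Finset.sum_congr rfl fun i _ => ?_
  by_cases hi : w i = 0
  · simp [hi]
  · rw [h i hi]

theorem sum_compl_le_of_mem_Delta {n : ℕ} {ε : ℝ} {w : Fin n → ℝ} (hw : w ∈ Delta n ε)
    (hε : ε < 1) (hn : 0 < n) {G : Finset (Fin n)} (hG : (1 - ε) * n ≤ (G.card : ℝ)) :
    ∑ i ∈ Gᶜ, w i ≤ ε / (1 - ε) := by
  have hn' : (0 : ℝ) < n := by exact_mod_cast hn
  have h1 : (0 : ℝ) < 1 - ε := by linarith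
  have hcard : ((Gᶜ.card : ℕ) : ℝ) ≤ ε * n := by
    have h : (G.card : ℝ) + (Gᶜ.card : ℝ) = n := by
      exact_mod_cast (Finset.card_add_card_compl G).trans (Fintype.card_fin n)
    linarith
  calc ∑ i ∈ Gᶜ, w i ≤ ∑ _i ∈ Gᶜ, 1 / ((1 - ε) * n) := Finset.sum_le_sum fun i _ => (hw.2 i).2
    _ = Gᶜ.card * (1 / ((1 - ε) * n)) := by simp
    _ ≤ ε * n * (1 / ((1 - ε) * n)) := by gcongr
    _ = ε / (1 - ε) := by field_simp

theorem uniformOn_mem_Delta {n : ℕ} {ε : ℝ} (hε₀ : 0 ≤ ε) (hε : ε < 1 / 2) (hn : 0 < n)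
    {G : Finset (Fin n)} (hG : (1 - ε) * n ≤ (G.card : ℝ)) :
    uniformOn G ∈ Delta n (2 * ε) := by
  have hn' : (0 : ℝ) < n := by exact_mod_cast hn
  have hpos : 0 < (1 - 2 * ε) * n := mul_pos (by linarith) hn'
  have hle : (1 - 2 * ε) * n ≤ (G.card : ℝ) :=
    (mul_le_mul_of_nonneg_right (by linarith) hn'.le).trans hG
  have hcard : (0 : ℝ) < G.card := hpos.trans_le hle
  refine ⟨?_, fun i => ?_⟩
  · simp [uniformOn, hcard.ne']
  · unfold uniformOn
    split_ifs
    · exact ⟨by positivity, by rw [← one_div]; exact one_div_le_one_div_of_le hpos hle⟩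
    · exact ⟨le_rfl, by positivity⟩

/-- The weights `w` conditioned on the index set `G`. -/
noncomputable def condWeights {n : ℕ} (w : Fin n → ℝ) (G : Finset (Fin n)) : Fin n → ℝ :=
  fun i => if i ∈ G then (∑ j ∈ G, w j)⁻¹ * w i else 0

theorem sum_condWeights_mul {n : ℕ} (w : Fin n → ℝ) (G : Finset (Fin n)) (f : Fin n → ℝ) :
    ∑ i, condWeights w G i * f i = (∑ j ∈ G, w j)⁻¹ * ∑ i ∈ G, w i * f i := by
  simp [condWeights, ite_mul, Finset.mul_sum, mul_assoc]

theorem condWeights_mem_Delta {n : ℕ} {ε : ℝ} {w : Fin n → ℝ} (hw : w ∈ Delta n ε)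
    (hε : ε < 1 / 2) (hn : 0 < n) {G : Finset (Fin n)}
    (hG : (1 - ε) * n ≤ (G.card : ℝ)) : condWeights w G ∈ Delta n (2 * ε) := by
  have hn' : (0 : ℝ) < n := by exact_mod_cast hn
  have h1 : 0 < 1 - ε := by linarith
  have h2 : 0 < 1 - 2 * ε := by linarith
  have hcompl := sum_compl_le_of_mem_Delta hw (by linarith) hn hG
  have hsplit : ∑ i ∈ G, w i + ∑ i ∈ Gᶜ, w i = 1 := (Finset.sum_add_sum_compl G w).trans hw.1
  have hmass : (1 - 2 * ε) / (1 - ε) ≤ ∑ i ∈ G, w i := by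
    have : (1 - 2 * ε) / (1 - ε) = 1 - ε / (1 - ε) := by field_simp; ring
    linarith
  have hmass_pos : 0 < ∑ i ∈ G, w i := (div_pos h2 h1).trans_le hmass
  refine ⟨?_, fun i => ?_⟩
  · have h := sum_condWeights_mul w G fun _ => 1
    simpa [hmass_pos.ne'] using h
  · unfold condWeights
    split_ifs
    · refine ⟨mul_nonneg (inv_nonneg.2 hmass_pos.le) (hw.2 i).1, ?_⟩
      calc (∑ j ∈ G, w j)⁻¹ * w i
          ≤ ((1 - 2 * ε) / (1 - ε))⁻¹ * (1 / ((1 - ε) * n)) :=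
            mul_le_mul (inv_anti₀ (div_pos h2 h1) hmass) (hw.2 i).2 (hw.2 i).1
              (inv_nonneg.2 (div_pos h2 h1).le)
        _ = 1 / ((1 - 2 * ε) * n) := by field_simp
    · exact ⟨le_rfl, by positivity⟩

/-- A shift of the mean caused by the indices outside `G` forces variance of order
`shift² / (mass outside G)` on top of the variance inside `G`. -/
theorem sum_mul_sq_ge_of_split {n : ℕ} {w y : Fin n → ℝ} (hw : ∀ i, 0 ≤ w i)
    (hsum : ∑ i, w i = 1) {G : Finset (Fin n)} (hG : 0 < ∑ i ∈ G, w i) :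
    (∑ i ∈ G, w i) * (∑ i ∈ Gᶜ, w i) *
        (∑ i, condWeights w G i * (y i - ∑ j, condWeights w G j * y j) ^ 2) +
      (∑ i ∈ G, w i) ^ 2 * (∑ i, w i * y i - ∑ i, condWeights w G i * y i) ^ 2 ≤
    (∑ i ∈ Gᶜ, w i) * ∑ i, w i * (y i - ∑ j, w j * y j) ^ 2 := by
  set a := ∑ i ∈ G, w i with ha
  set b := ∑ i ∈ Gᶜ, w i with hb
  set m := ∑ i, w i * y i with hm
  set g := ∑ i, condWeights w G i * y i with hg
  have hb0 : 0 ≤ b := Finset.sum_nonneg fun i _ => hw i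
  have hab : a + b = 1 := (Finset.sum_add_sum_compl G w).trans hsum
  have hga : ∑ i ∈ G, w i * y i = a * g := by
    rw [hg, sum_condWeights_mul, ← ha, mul_inv_cancel_left₀ hG.ne']
  have hgc : ∑ i ∈ Gᶜ, w i * y i = m - a * g := by
    have := Finset.sum_add_sum_compl G fun i => w i * y i
    linarith
  have hvar : a * ∑ i, condWeights w G i * (y i - g) ^ 2 = ∑ i ∈ G, w i * (y i - g) ^ 2 := by
    rw [sum_condWeights_mul, ← ha, mul_inv_cancel_left₀ hG.ne']
  have hshift : ∑ i ∈ G, w i * (y i - g) ^ 2 ≤ ∑ i ∈ G, w i * (y i - m) ^ 2 := by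
    have h : ∀ i, w i * (y i - m) ^ 2 =
        w i * (y i - g) ^ 2 + 2 * (g - m) * (w i * y i) + (m ^ 2 - g ^ 2) * w i :=
      fun i => by ring
    simp only [h, Finset.sum_add_distrib, ← Finset.mul_sum, hga, ← ha]
    nlinarith [mul_nonneg hG.le (sq_nonneg (g - m))]
  have hcs : (∑ i ∈ Gᶜ, w i * (y i - m)) ^ 2 ≤ b * ∑ i ∈ Gᶜ, w i * (y i - m) ^ 2 :=
    Finset.sum_sq_le_sum_mul_sum_of_sq_le_mul _ (fun i _ => hw i)
      (fun i _ => mul_nonneg (hw i) (sq_nonneg _)) fun i _ => le_of_eq (by ring)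
  have hdev : ∑ i ∈ Gᶜ, w i * (y i - m) = a * (m - g) := by
    simp only [mul_sub, Finset.sum_sub_distrib, ← Finset.sum_mul, hgc, ← hb]
    rw [eq_sub_of_add_eq' hab]
    ring
  rw [hdev] at hcs
  rw [← Finset.sum_add_sum_compl G fun i => w i * (y i - m) ^ 2]
  have := mul_le_mul_of_nonneg_left hshift hb0
  rw [← hvar] at this
  linarith

/-- If a reweighting of the corrupted sample has its mean at distance at least `10 δ` from `μ`,
then its covariance deviates from the identity by far more than the stability bound. -/
theorem specNorm_SigmaW_sub_one_ge {n d : ℕ} {ε δ : ℝ} {μ : Fin d → ℝ}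
    {Xstar X : Fin n → Fin d → ℝ} {G : Finset (Fin n)} (hε : 0 < ε) (hε' : ε ≤ 1 / 10)
    (hδ : ε ≤ δ) (hstab : stableSpec ε δ Xstar μ) (hX : ∀ i ∈ G, X i = Xstar i)
    (hG : (1 - ε) * n ≤ (G.card : ℝ)) (hn : 0 < n) {w : Fin n → ℝ} (hw : w ∈ Delta n ε)
    (hfar : 10 * δ ≤ norm2 (muW X w - μ)) :
    2 * (δ ^ 2 / ε + (norm2 (muW X w - μ) + δ) ^ 2) ≤ specNorm (SigmaW X w - 1) := by
  set r := norm2 (muW X w - μ) with hr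
  have hδ0 : 0 < δ := hε.trans_le hδ
  have hr0 : 0 < r := by linarith
  set v : Fin d → ℝ := r⁻¹ • (muW X w - μ) with hv
  have hv1 : norm2 v = 1 := by
    rw [hv, norm2_smul, abs_of_pos (inv_pos.2 hr0), ← hr, inv_mul_cancel₀ hr0.ne']
  have hvr : v ⬝ᵥ (muW X w - μ) = r := by
    rw [hv, smul_dotProduct, ← norm2_sq, ← hr, smul_eq_mul]
    field_simp
  have hu := condWeights_mem_Delta hw (by linarith) hn hG
  have hXu : ∀ i, condWeights w G i ≠ 0 → Xstar i = X i := fun i hi => by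
    refine (hX i ?_).symm
    by_contra h
    exact hi (by simp [condWeights, h])
  obtain ⟨hmean, hcov⟩ := hstab _ hu
  change norm2 (muW Xstar _ - μ) ≤ δ at hmean
  rw [muW_congr hXu] at hmean
  rw [SigmaW_congr hXu] at hcov
  have hgood_mean : v ⬝ᵥ (muW X (condWeights w G) - μ) ≤ δ := by
    have h := abs_dotProduct_le_norm2_mul_norm2 v (muW X (condWeights w G) - μ)
    rw [hv1, one_mul] at h
    exact (le_abs_self _).trans (h.trans hmean)
  have hgood_var : 1 - δ ^ 2 / ε ≤ v ⬝ᵥ (SigmaW X (condWeights w G)).mulVec v := by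
    have h := abs_dotProduct_mulVec_sub_one_le_specNorm (SigmaW X (condWeights w G)) hv1
    linarith [(abs_le.1 (h.trans hcov)).1]
  have hvar : v ⬝ᵥ (SigmaW X w).mulVec v ≤ 1 + specNorm (SigmaW X w - 1) := by
    have h := abs_dotProduct_mulVec_sub_one_le_specNorm (SigmaW X w) hv1
    linarith [(abs_le.1 h).2]
  have hcompl : ∑ i ∈ Gᶜ, w i ≤ 10 / 9 * ε := by
    refine (sum_compl_le_of_mem_Delta hw (by linarith) hn hG).trans ?_
    rw [div_le_iff₀ (by linarith)]
    nlinarith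
  have hcompl0 : 0 ≤ ∑ i ∈ Gᶜ, w i := Finset.sum_nonneg fun i _ => (hw.2 i).1
  have hab : ∑ i ∈ G, w i + ∑ i ∈ Gᶜ, w i = 1 := (Finset.sum_add_sum_compl G w).trans hw.1
  have hsplit := sum_mul_sq_ge_of_split (y := fun i => v ⬝ᵥ X i) (fun i => (hw.2 i).1) hw.1
    (G := G) (by linarith)
  simp only [← dotProduct_muW, ← dotProduct_SigmaW_mulVec] at hsplit
  rw [dotProduct_sub] at hvr hgood_mean
  set a := ∑ i ∈ G, w i
  set b := ∑ i ∈ Gᶜ, w i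
  set V := v ⬝ᵥ (SigmaW X w).mulVec v
  set L := specNorm (SigmaW X w - 1)
  set U := v ⬝ᵥ (SigmaW X (condWeights w G)).mulVec v
  set q := δ ^ 2 / ε with hq
  have hqε : q * ε = δ ^ 2 := div_mul_cancel₀ _ hε.ne'
  have hεq : ε ≤ q := by rw [hq, le_div_iff₀ hε]; nlinarith
  have hmean_shift : 64 / 81 * (r - δ) ^ 2 ≤
      a ^ 2 * (v ⬝ᵥ muW X w - v ⬝ᵥ muW X (condWeights w G)) ^ 2 := by
    have h1 : (8 / 9 : ℝ) ≤ a := by linarith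
    have h2 : r - δ ≤ v ⬝ᵥ muW X w - v ⬝ᵥ muW X (condWeights w G) := by linarith
    have h3 : 0 ≤ r - δ := by linarith
    calc 64 / 81 * (r - δ) ^ 2 = (8 / 9) ^ 2 * (r - δ) ^ 2 := by norm_num
      _ ≤ _ := by gcongr
  have hbase : b * (1 - 3 * q) ≤ a * b * U := by
    have h1 : 1 - 3 * q ≤ a * U := by nlinarith
    linarith [mul_le_mul_of_nonneg_left h1 hcompl0]
  have hkey : 64 / 81 * (r - δ) ^ 2 ≤ b * (L + 3 * q) := by
    nlinarith [mul_le_mul_of_nonneg_left hvar hcompl0]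
  have hL : 0 ≤ L + 3 * q := add_nonneg (specNorm_nonneg _) (by positivity)
  have hkey' : 64 / 81 * (r - δ) ^ 2 ≤ 10 / 9 * ε * (L + 3 * q) :=
    hkey.trans (mul_le_mul_of_nonneg_right hcompl hL)
  refine le_of_mul_le_mul_left ?_ hε
  have hεr : ε * (r + δ) ^ 2 ≤ 1 / 10 * (r + δ) ^ 2 := by gcongr
  nlinarith

/-- (non-sparse, spectral-norm analogue of Statement 5) if `μ_w` is far
from `μ`, moving toward the uniform weights on good samples decreases `‖Σ_w − I‖₂`. -/
theorem stmt16 :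
    ∃ c₂ > (0:ℝ),
      ∀ (n d : ℕ) (ε δ : ℝ) (μ : Fin d → ℝ) (Xstar X : Fin n → Fin d → ℝ)
        (G : Finset (Fin n)) (wstar : Fin n → ℝ),
        0 < ε → ε ≤ 1/10 → ε ≤ δ →
        stableSpec ε δ Xstar μ →
        isCorruption ε X Xstar →
        (∀ i ∈ G, X i = Xstar i) →
        (1 - ε) * n ≤ (G.card : ℝ) →
        wstar = uniformOn G →
        ∀ w ∈ Delta n ε,
          c₂ * δ ≤ norm2 (fun j => muW X w j - μ j) →
          ∀ η : ℝ, 0 < η → η < 1 →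
            specNorm (SigmaW X (fun i => (1 - η) * w i + η * wstar i) - 1)
              ≤ (1 - η / 2) * specNorm (SigmaW X w - 1) := by
  refine ⟨10, by norm_num, ?_⟩
  intro n d ε δ μ Xstar X G wstar hε hε' hδ hstab _ hX hG hwstar w hw hfar η hη₀ hη₁
  subst hwstar
  have hn : 0 < n := by
    rcases Nat.eq_zero_or_pos n with rfl | h
    · simpa using hw.1
    · exact h
  change 10 * δ ≤ norm2 (muW X w - μ) at hfar
  have hbig := specNorm_SigmaW_sub_one_ge hε hε' hδ hstab hX hG hn hw hfar
  have hu := uniformOn_mem_Delta hε.le (by linarith) hn hG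
  have hXu : ∀ i, uniformOn G i ≠ 0 → Xstar i = X i := fun i hi => by
    refine (hX i ?_).symm
    by_contra h
    exact hi (by simp [uniformOn, h])
  obtain ⟨hmean, hcov⟩ := hstab _ hu
  change norm2 (muW Xstar _ - μ) ≤ δ at hmean
  rw [muW_congr hXu] at hmean
  rw [SigmaW_congr hXu] at hcov
  set u := muW X w - muW X (uniformOn G) with hu_def
  have hu_norm : norm2 u ≤ norm2 (muW X w - μ) + δ := by
    have h := norm2_sub_le (muW X w - μ) (muW X (uniformOn G) - μ)
    rw [sub_sub_sub_cancel_right] at h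
    linarith
  have hu_sq : norm2 u ^ 2 ≤ (norm2 (muW X w - μ) + δ) ^ 2 :=
    pow_le_pow_left₀ (norm2_nonneg u) hu_norm 2
  have hdecomp : SigmaW X (fun i => (1 - η) * w i + η * uniformOn G i) - 1 =
      (1 - η) • (SigmaW X w - 1) + η • (SigmaW X (uniformOn G) - 1) +
        (η * (1 - η)) • Matrix.vecMulVec u u := by
    rw [SigmaW_convexCombination X hw.1 hu.1]
    module
  have hη : 0 ≤ 1 - η := by linarith
  have hηη : 0 ≤ η * (1 - η) := mul_nonneg hη₀.le hη
  calc specNorm (SigmaW X (fun i => (1 - η) * w i + η * uniformOn G i) - 1)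
      ≤ (1 - η) * specNorm (SigmaW X w - 1) + η * specNorm (SigmaW X (uniformOn G) - 1) +
          η * (1 - η) * specNorm (Matrix.vecMulVec u u) := by
        rw [hdecomp]
        refine (specNorm_add_le _ _).trans (add_le_add ((specNorm_add_le _ _).trans
          (add_le_add ?_ ?_)) ?_) <;> apply specNorm_smul_le <;> linarith
    _ ≤ (1 - η) * specNorm (SigmaW X w - 1) + η * (δ ^ 2 / ε) +
          η * 1 * (norm2 (muW X w - μ) + δ) ^ 2 := by
        gcongr
        · exact specNorm_nonneg _
        · linarith
        · exact (specNorm_vecMulVec_self_le u).trans hu_sq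
    _ ≤ (1 - η / 2) * specNorm (SigmaW X w - 1) := by
        linarith [mul_le_mul_of_nonneg_left hbig hη₀.le]
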